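/- For every k ≥ 3, n ≥ 1, and 0 < δ < 1, the maximum over pure strategy profiles a ∈ [k]^n of the total variation distance d_TV(e_1 + N(a^δ), e_2 + N(a^δ)) is at least P(S_n^{2δ/k} ∈ {0,1}), where (S_m^r) is the lazy symmetric random walk on ℤ with rate r; in fact the profile in which all n players take action 3 attains this lower bound. -/

import Mathlib

open Finset

/-- `perturbW k δ a j` is the probability that the `δ`-perturbation of the pure
action `a ∈ [k]` plays the action `j`: with probability `1-δ` play `a`, with
probability `δ` play uniformly in `[k]`. -/
noncomputable def perturbW (k : ℕ) (δ : ℝ) (a j : Fin k) : ℝ :=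
  (1 - δ) * (if j = a then 1 else 0) + δ / k

/-- Probability that the (independent) `δ`-perturbation of the pure profile `a`
realises as the pure profile `b`. -/
noncomputable def profW (n k : ℕ) (δ : ℝ) (a b : Fin n → Fin k) : ℝ :=
  ∏ i, perturbW k δ (a i) (b i)

/-- A game: payoffs lie in `[0,1]`. -/
def IsGame (n k : ℕ) (g : (Fin n → Fin k) → Fin n → ℝ) : Prop :=
  ∀ a i, g a i ∈ Set.Icc (0 : ℝ) 1

/-- The number of players taking action `j` in the profile `a`. -/
def actCount (n k : ℕ) (a : Fin n → Fin k) (j : Fin k) : ℕ :=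
  (Finset.univ.filter fun i => a i = j).card

/-- A game is anonymous if each player's payoff depends only on his own action and
on the number of players taking each action. -/
def IsAnonymous (n k : ℕ) (g : (Fin n → Fin k) → Fin n → ℝ) : Prop :=
  ∀ (a b : Fin n → Fin k) (i : Fin n), a i = b i →
    (∀ j, actCount n k a j = actCount n k b j) → g a i = g b i

/-- The `δ`-perturbed game `g^δ`. -/
noncomputable def perturbGame (n k : ℕ) (δ : ℝ) (g : (Fin n → Fin k) → Fin n → ℝ) :
    (Fin n → Fin k) → Fin n → ℝ :=
  fun a i => ∑ b : Fin n → Fin k, profW n k δ a b * g b i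

/-- The Lipschitz constant of a game: the largest change of some player's payoff
when a single opponent changes his action. -/
noncomputable def lipC (n k : ℕ) (g : (Fin n → Fin k) → Fin n → ℝ) : ℝ :=
  sSup {x | ∃ (i : Fin n) (a b : Fin n → Fin k), a i = b i ∧
    (Finset.univ.filter fun j => a j ≠ b j).card = 1 ∧ x = |g a i - g b i|}

/-- The worst-case Lipschitz constant of `δ`-perturbed `n`-player `k`-action
anonymous games. -/
noncomputable def lam (n k : ℕ) (δ : ℝ) : ℝ :=
  sSup {x | ∃ g : (Fin n → Fin k) → Fin n → ℝ,
    IsGame n k g ∧ IsAnonymous n k g ∧ x = lipC n k (perturbGame n k δ g)}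
/-- `walk r m z` is the probability that the lazy symmetric random walk on `ℤ` with
rate `r` (i.i.d. increments: `0` w.p. `1-r`, `±1` w.p. `r/2` each), started at `0`,
is at `z` after `m` steps; i.e. `P(S_m^r = z)`. -/
noncomputable def walk (r : ℝ) : ℕ → ℤ → ℝ
  | 0, z => if z = 0 then 1 else 0
  | m + 1, z => (1 - r) * walk r m z + r / 2 * walk r m (z - 1) + r / 2 * walk r m (z + 1)
/-- The `j`-th standard basis vector of `ℤ^k`. -/
def basisVec (k : ℕ) (j : Fin k) : Fin k → ℤ := fun j' => if j' = j then 1 else 0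

/-- The vector counting how many players take each action in the profile `a`,
viewed in `ℤ^k`. -/
def countVec (n k : ℕ) (a : Fin n → Fin k) : Fin k → ℤ :=
  fun j => ((Finset.univ.filter fun i => a i = j).card : ℤ)

/-- `shiftCountDist n k δ a v x` is the probability `P(v + N(a^δ) = x)`, i.e. the
distribution of the action-count vector of the `δ`-perturbation of the profile `a`,
shifted by the vector `v ∈ ℤ^k`. -/
noncomputable def shiftCountDist (n k : ℕ) (δ : ℝ) (a : Fin n → Fin k)
    (v : Fin k → ℤ) (x : Fin k → ℤ) : ℝ :=
  ∑ b : Fin n → Fin k, profW n k δ a b * (if v + countVec n k b = x then 1 else 0)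

/-- The total variation distance between two distributions on `α`, given by their
probability mass functions: the supremum over events `A ⊆ α` of the discrepancy. -/
noncomputable def dTV {α : Type*} (P Q : α → ℝ) : ℝ :=
  sSup {x | ∃ A : Set α, x = |(∑' a : A, P a) - (∑' a : A, Q a)|}

/-- The mass that a shifted count distribution gives to an event. -/
lemma tsum_shiftCountDist (n k : ℕ) (δ : ℝ) (a : Fin n → Fin k) (v : Fin k → ℤ)
    (A : Set (Fin k → ℤ)) [DecidablePred (· ∈ A)] :
    ∑' x : A, shiftCountDist n k δ a v x =
      ∑ b, profW n k δ a b * (if v + countVec n k b ∈ A then 1 else 0) := by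
  unfold shiftCountDist
  refine HasSum.tsum_eq (hasSum_sum fun b _ => HasSum.mul_left _ ?_)
  split_ifs with h
  · have heq : (fun x : A => if v + countVec n k b = x then (1 : ℝ) else 0) =
        fun x => if x = ⟨v + countVec n k b, h⟩ then 1 else 0 :=
      funext fun x => if_congr ⟨fun hx => Subtype.ext hx.symm, fun hx => hx ▸ rfl⟩ rfl rfl
    exact heq ▸ hasSum_ite_eq _ _
  · have heq : (fun x : A => if v + countVec n k b = x then (1 : ℝ) else 0) = fun _ => 0 :=
      funext fun x => if_neg fun hx : v + countVec n k b = x => h (hx ▸ x.2)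
    exact heq ▸ hasSum_zero

lemma bddAbove_dTV_shiftCountDist (n k : ℕ) (δ : ℝ) (a : Fin n → Fin k) (v w : Fin k → ℤ) :
    BddAbove {x | ∃ A : Set (Fin k → ℤ), x = |(∑' y : A, shiftCountDist n k δ a v y) -
      (∑' y : A, shiftCountDist n k δ a w y)|} := by
  classical
  refine ⟨∑ b, |profW n k δ a b|, ?_⟩
  rintro _ ⟨A, rfl⟩
  rw [tsum_shiftCountDist, tsum_shiftCountDist, ← Finset.sum_sub_distrib]
  refine (Finset.abs_sum_le_sum_abs _ _).trans (Finset.sum_le_sum fun b _ => ?_)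
  split_ifs <;> simp

lemma sum_perturbW_mul {k : ℕ} (δ : ℝ) {p q c : Fin k} (hpq : p ≠ q) (hcp : c ≠ p)
    (hcq : c ≠ q) (f : ℤ → ℝ) :
    ∑ j, perturbW k δ c j * f (basisVec k j p - basisVec k j q) =
      (1 - 2 * δ / k) * f 0 + δ / k * f 1 + δ / k * f (-1) := by
  have hk : (k : ℝ) ≠ 0 := Nat.cast_ne_zero.2 p.pos.ne'
  have hf (j : Fin k) : perturbW k δ c j * f (basisVec k j p - basisVec k j q) =
      (1 - δ) * f 0 * (if j = c then 1 else 0) + δ / k * f 0 +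
        δ / k * (f 1 - f 0) * (if j = p then 1 else 0) +
        δ / k * (f (-1) - f 0) * (if j = q then 1 else 0) := by
    unfold perturbW basisVec
    by_cases h1 : j = c
    · subst h1
      simp [hcp, hcq, hcp.symm, hcq.symm]
      ring
    by_cases h2 : j = p
    · subst h2
      simp [h1, hpq, hpq.symm]
      ring
    by_cases h3 : j = q
    · subst h3
      simp [h1, hpq, hpq.symm]
      ring
    simp [h1, h2, h3, Ne.symm h2, Ne.symm h3]
  simp only [hf, Finset.sum_add_distrib, ← Finset.mul_sum, Finset.sum_ite_eq',
    Finset.mem_univ, if_true, Finset.sum_const, Finset.card_univ, Fintype.card_fin,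
    nsmul_eq_mul]
  field_simp
  ring

lemma countVec_cons (n k : ℕ) (j : Fin k) (b : Fin n → Fin k) :
    countVec (n + 1) k (Fin.cons j b) = basisVec k j + countVec n k b := by
  ext i
  simp only [countVec, basisVec, Finset.card_filter, Fin.sum_univ_succ, Fin.cons_zero,
    Fin.cons_succ, Pi.add_apply, Nat.cast_add, Nat.cast_ite, Nat.cast_one, Nat.cast_zero,
    @eq_comm _ j i]

/-- When everybody plays `c`, the difference between the counts of two other actions is a
lazy symmetric random walk. -/
lemma sum_profW_count_sub_eq_walk {k : ℕ} (δ : ℝ) {p q c : Fin k} (hpq : p ≠ q) (hcp : c ≠ p)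
    (hcq : c ≠ q) (n : ℕ) (z : ℤ) :
    ∑ b, profW n k δ (fun _ => c) b * (if countVec n k b p - countVec n k b q = z then 1 else 0) =
      walk (2 * δ / k) n z := by
  induction n generalizing z with
  | zero => simp [profW, countVec, walk, eq_comm]
  | succ n ih =>
    rw [← (Fin.consEquiv fun _ => Fin k).sum_comp, Fintype.sum_prod_type]
    have hj (j : Fin k) : ∑ b : Fin n → Fin k,
        profW (n + 1) k δ (fun _ => c) (Fin.cons j b) *
          (if countVec (n + 1) k (Fin.cons j b) p -
            countVec (n + 1) k (Fin.cons j b) q = z then 1 else 0) =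
        perturbW k δ c j *
          walk (2 * δ / k) n (z - (basisVec k j p - basisVec k j q)) := by
      rw [← ih, Finset.mul_sum]
      refine Finset.sum_congr rfl fun b _ => ?_
      simp only [countVec_cons, profW, Fin.prod_univ_succ, Fin.cons_zero,
        Fin.cons_succ, Pi.add_apply, mul_assoc]
      congr 2
      exact if_congr ⟨fun h => by linarith, fun h => by linarith⟩ rfl rfl
    refine (Finset.sum_congr rfl fun j _ => hj j).trans ?_
    rw [sum_perturbW_mul δ hpq hcp hcq fun d => walk (2 * δ / k) n (z - d)]
    simp only [walk, sub_zero, sub_neg_eq_add]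
    ring

/-- For every `k ≥ 3`, `n ≥ 1`, and `0 < δ < 1`, the profile in which all players
take action `3` witnesses `max_a d_TV(e_1 + N(a^δ), e_2 + N(a^δ)) ≥
P(S_n^{2δ/k} ∈ {0,1})`. -/
theorem walk_le_tv_shiftCount (n k : ℕ) (hn : 1 ≤ n) (hk : 3 ≤ k)
    (δ : ℝ) (hδ0 : 0 < δ) (hδ1 : δ < 1) :
    walk (2 * δ / k) n 0 + walk (2 * δ / k) n 1
      ≤ dTV (shiftCountDist n k δ (fun _ => ⟨2, by omega⟩) (basisVec k ⟨0, by omega⟩))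
          (shiftCountDist n k δ (fun _ => ⟨2, by omega⟩) (basisVec k ⟨1, by omega⟩)) := by
  classical
  set p : Fin k := ⟨0, by omega⟩
  set q : Fin k := ⟨1, by omega⟩
  set c : Fin k := ⟨2, by omega⟩
  have hpq : p ≠ q := by simp [p, q]
  have hcp : c ≠ p := by simp [p, c]
  have hcq : c ≠ q := by simp [q, c]
  refine le_trans (le_trans (le_of_eq ?_) (le_abs_self _))
    (le_csSup (bddAbove_dTV_shiftCountDist n k δ _ _ _) ⟨{x | x q < x p}, rfl⟩)
  rw [tsum_shiftCountDist, tsum_shiftCountDist, ← Finset.sum_sub_distrib,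
    ← sum_profW_count_sub_eq_walk δ hpq hcp hcq, ← sum_profW_count_sub_eq_walk δ hpq hcp hcq,
    ← Finset.sum_add_distrib]
  refine Finset.sum_congr rfl fun b _ => ?_
  rw [← mul_add, ← mul_sub]
  congr 1
  simp only [Set.mem_ofPred_eq, Pi.add_apply, basisVec, hpq, hpq.symm, if_true, if_false]
  split_ifs <;> first | omega | norm_num
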